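/- arXiv:2112.11388 — 3 statements merged into one kernel-verified Lean document; each statement's English description precedes it below -/
import Mathlib

section
/- Let E be a finite-dimensional real inner product space, let p > 0 be real, let 0 < h ≤ 1, and let (h̃_n)_{n≥1} be reals with 0 < h̃_n ≤ 1 and S := Σ_{n=1}^{∞} h̃_n^{p+1} < ∞. Set h_n := h·h̃_n. Let (L_n)_{n≥1} be invertible continuous linear maps on E and (Φ_n)_{n≥1} continuous linear maps on E, with L_m^n := L_n ∘ ⋯ ∘ L_{m+1}, Φ_m^n := Φ_n ∘ ⋯ ∘ Φ_{m+1}. Assume there are constants c₁, c₂, c₃ > 0 such that ‖L_n⁻¹‖ ≤ c₁ for all n, ‖L_n^N‖·‖L_0^n‖ ≤ c₂ ‖L_0^N‖ for all 0 ≤ n ≤ N, and ‖L_n − Φ_n‖ ≤ c₃ h_n^{p+1} for all n. Then there is a constant c' > 0, independent of N and of h (one may take c' = c₁c₂c₃·S·exp(c₁c₂c₃·S)), such that for all N ≥ 1: ‖L_0^N − Φ_0^N‖ ≤ c' h^{p+1} ‖L_0^N‖. -/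
open Finset

/-- `seqComp L m n = L n ∘ L (n-1) ∘ ⋯ ∘ L (m+1)`, with `seqComp L m n = id` for `n ≤ m`. -/
noncomputable def seqComp {E : Type*} [NormedAddCommGroup E] [NormedSpace ℝ E]
    (L : ℕ → E →L[ℝ] E) (m : ℕ) : ℕ → E →L[ℝ] E
  | 0 => 1
  | n + 1 => if m ≤ n then L (n + 1) ∘L seqComp L m n else 1

section SeqComp

variable {E : Type*} [NormedAddCommGroup E] [NormedSpace ℝ E]

theorem seqComp_zero_succ (L : ℕ → E →L[ℝ] E) (n : ℕ) :
    seqComp L 0 (n + 1) = L (n + 1) ∘L seqComp L 0 n := by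
  simp [seqComp]

theorem seqComp_self (L : ℕ → E →L[ℝ] E) (n : ℕ) : seqComp L n n = 1 := by
  cases n <;> simp [seqComp]

/-- Telescoping formula for the difference of two composed flows. -/
theorem seqComp_sub_seqComp (L Φ : ℕ → E →L[ℝ] E) (N : ℕ) :
    seqComp L 0 N - seqComp Φ 0 N =
      ∑ n ∈ range N, seqComp L (n + 1) N ∘L (L (n + 1) - Φ (n + 1)) ∘L seqComp Φ 0 n := by
  induction N with
  | zero => simp [seqComp]
  | succ N ih =>
    have step : ∀ n ∈ range N,
        seqComp L (n + 1) (N + 1) ∘L (L (n + 1) - Φ (n + 1)) ∘L seqComp Φ 0 n =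
          L (N + 1) * (seqComp L (n + 1) N ∘L (L (n + 1) - Φ (n + 1)) ∘L seqComp Φ 0 n) := by
      intro n hn
      have hnN : n + 1 ≤ N := mem_range.mp hn
      rw [show seqComp L (n + 1) (N + 1) = L (N + 1) ∘L seqComp L (n + 1) N by
        simp [seqComp, hnN]]
      rfl
    rw [sum_range_succ, sum_congr rfl step, ← mul_sum, ← ih, seqComp_self, seqComp_zero_succ,
      seqComp_zero_succ]
    change L (N + 1) * seqComp L 0 N - Φ (N + 1) * seqComp Φ 0 N =
      L (N + 1) * (seqComp L 0 N - seqComp Φ 0 N) +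
        1 * ((L (N + 1) - Φ (N + 1)) * seqComp Φ 0 N)
    noncomm_ring

theorem norm_seqComp_le_mul_norm_seqComp_succ (L : ℕ → (E ≃L[ℝ] E)) {c : ℝ} {n : ℕ}
    (hinv : ‖((L (n + 1)).symm : E →L[ℝ] E)‖ ≤ c) :
    ‖seqComp (fun k => (L k : E →L[ℝ] E)) 0 n‖ ≤
      c * ‖seqComp (fun k => (L k : E →L[ℝ] E)) 0 (n + 1)‖ := by
  have key : seqComp (fun k => (L k : E →L[ℝ] E)) 0 n =
      ((L (n + 1)).symm : E →L[ℝ] E) ∘L seqComp (fun k => (L k : E →L[ℝ] E)) 0 (n + 1) := by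
    ext x
    simp [seqComp_zero_succ]
  calc _ ≤ ‖((L (n + 1)).symm : E →L[ℝ] E)‖ *
        ‖seqComp (fun k => (L k : E →L[ℝ] E)) 0 (n + 1)‖ := by
        conv_lhs => rw [key]
        exact ContinuousLinearMap.opNorm_comp_le _ _
    _ ≤ _ := by gcongr

theorem norm_seqComp_pos [Nontrivial E] (L : ℕ → (E ≃L[ℝ] E)) (n : ℕ) :
    0 < ‖seqComp (fun k => (L k : E →L[ℝ] E)) 0 n‖ := by
  induction n with
  | zero => simp [seqComp]
  | succ n ih =>
    exact pos_of_mul_pos_right (ih.trans_le (norm_seqComp_le_mul_norm_seqComp_succ L le_rfl))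
      (norm_nonneg _)

end SeqComp

/-- A discrete Grönwall inequality. -/
theorem one_add_le_exp_sum_of_le_sum {u β : ℕ → ℝ} (hβ : ∀ n, 0 ≤ β n)
    (hu : ∀ N, u N ≤ ∑ n ∈ range N, β n * (1 + u n)) (N : ℕ) :
    1 + u N ≤ Real.exp (∑ n ∈ range N, β n) := by
  suffices hv : 1 + ∑ n ∈ range N, β n * (1 + u n) ≤ Real.exp (∑ n ∈ range N, β n) by
    linarith [hu N]
  induction N with
  | zero => simp
  | succ N ih =>
    rw [sum_range_succ, sum_range_succ, Real.exp_add]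
    have h₁ : β N * (1 + u N) ≤ β N * Real.exp (∑ n ∈ range N, β n) :=
      mul_le_mul_of_nonneg_left (by linarith [hu N]) (hβ N)
    have h₂ := mul_le_mul_of_nonneg_left (Real.add_one_le_exp (β N))
      (Real.exp_pos (∑ n ∈ range N, β n)).le
    linarith

theorem exp_sub_one_le_mul_exp (x : ℝ) : Real.exp x - 1 ≤ x * Real.exp x := by
  have h₁ := mul_le_mul_of_nonneg_left (Real.add_one_le_exp (-x)) (Real.exp_pos x).le
  rw [← Real.exp_add, add_neg_cancel, Real.exp_zero] at h₁
  linarith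

/-- **Uniform relative global integration error bound under a summable stepsize rule.**
Let `E` be a finite-dimensional real inner product space, `p > 0`, `0 < h ≤ 1`, and let
`(h̃ n)_{n≥1}` satisfy `0 < h̃ n ≤ 1` with `∑_{n=1}^∞ (h̃ n)^(p+1) < ∞`; set `h_n = h * h̃ n`.
Let `(L n)` be invertible continuous linear maps and `(Φ n)` continuous linear maps on `E`
with `‖(L n)⁻¹‖ ≤ c₁`, `‖L_n^N‖ * ‖L_0^n‖ ≤ c₂ * ‖L_0^N‖` for `n ≤ N`, and
`‖L n − Φ n‖ ≤ c₃ * (h_n)^(p+1)`. Then with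
`c' = c₁c₂c₃ * S * exp (c₁c₂c₃ * S)` where `S = ∑_{n=1}^∞ (h̃ n)^(p+1)` (a constant
independent of `N` and `h`), for all `N ≥ 1`: `‖L_0^N − Φ_0^N‖ ≤ c' * h^(p+1) * ‖L_0^N‖`. -/
theorem uniform_relative_global_error_bound
    {E : Type*} [NormedAddCommGroup E] [InnerProductSpace ℝ E] [FiniteDimensional ℝ E]
    (p : ℝ) (hp : 0 < p) (h : ℝ) (hh0 : 0 < h) (hh1 : h ≤ 1)
    (ht : ℕ → ℝ) (hht : ∀ n, 1 ≤ n → 0 < ht n ∧ ht n ≤ 1)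
    (hsum : Summable fun n : ℕ => ht (n + 1) ^ (p + 1))
    (L : ℕ → (E ≃L[ℝ] E)) (Φ : ℕ → E →L[ℝ] E)
    (c₁ c₂ c₃ : ℝ) (hc₁ : 0 < c₁) (hc₂ : 0 < c₂) (hc₃ : 0 < c₃)
    (hinv : ∀ n, 1 ≤ n → ‖((L n).symm : E →L[ℝ] E)‖ ≤ c₁)
    (hfi : ∀ n N, n ≤ N →
      ‖seqComp (fun k => (L k : E →L[ℝ] E)) n N‖ * ‖seqComp (fun k => (L k : E →L[ℝ] E)) 0 n‖
        ≤ c₂ * ‖seqComp (fun k => (L k : E →L[ℝ] E)) 0 N‖)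
    (hcons : ∀ n, 1 ≤ n → ‖(L n : E →L[ℝ] E) - Φ n‖ ≤ c₃ * (h * ht n) ^ (p + 1)) :
    ∀ N, 1 ≤ N →
      ‖seqComp (fun k => (L k : E →L[ℝ] E)) 0 N - seqComp Φ 0 N‖ ≤
        (c₁ * c₂ * c₃ * (∑' n : ℕ, ht (n + 1) ^ (p + 1)) *
            Real.exp (c₁ * c₂ * c₃ * ∑' n : ℕ, ht (n + 1) ^ (p + 1))) *
          h ^ (p + 1) * ‖seqComp (fun k => (L k : E →L[ℝ] E)) 0 N‖ := by
  intro N _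
  rcases subsingleton_or_nontrivial E with hE | hE
  · simp [Subsingleton.elim (seqComp (fun k => (L k : E →L[ℝ] E)) 0 N) 0,
      Subsingleton.elim (seqComp Φ 0 N) 0]
  set A : ℕ → E →L[ℝ] E := fun k => (L k : E →L[ℝ] E) with hA
  set S := ∑' n : ℕ, ht (n + 1) ^ (p + 1) with hS
  have hpow : ∀ n, 0 ≤ ht (n + 1) ^ (p + 1) := fun n =>
    Real.rpow_nonneg (hht (n + 1) (by omega)).1.le _
  have hhp : 0 ≤ h ^ (p + 1) := Real.rpow_nonneg hh0.le _
  have hhp1 : h ^ (p + 1) ≤ 1 := Real.rpow_le_one hh0.le hh1 (by linarith)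
  have hS0 : 0 ≤ S := tsum_nonneg hpow
  have hpos : ∀ n, 0 < ‖seqComp A 0 n‖ := norm_seqComp_pos L
  set u : ℕ → ℝ := fun n => ‖seqComp A 0 n - seqComp Φ 0 n‖ / ‖seqComp A 0 n‖ with hu_def
  set β : ℕ → ℝ := fun n => c₁ * c₂ * c₃ * h ^ (p + 1) * ht (n + 1) ^ (p + 1) with hβ_def
  have hβ : ∀ n, 0 ≤ β n := fun n => mul_nonneg (by positivity) (hpow n)
  have hu : ∀ M, u M ≤ ∑ n ∈ range M, β n * (1 + u n) := by
    intro M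
    rw [hu_def, div_le_iff₀ (hpos M), seqComp_sub_seqComp, sum_mul]
    refine (norm_sum_le _ _).trans (sum_le_sum fun n hn => ?_)
    have hstep : ‖A (n + 1) - Φ (n + 1)‖ ≤ c₃ * (h ^ (p + 1) * ht (n + 1) ^ (p + 1)) := by
      rw [← Real.mul_rpow hh0.le (hht (n + 1) (by omega)).1.le]
      exact hcons (n + 1) (by omega)
    have hε : 0 ≤ c₃ * (h ^ (p + 1) * ht (n + 1) ^ (p + 1)) := (norm_nonneg _).trans hstep
    have hback : ‖seqComp A 0 n‖ ≤ c₁ * ‖seqComp A 0 (n + 1)‖ :=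
      norm_seqComp_le_mul_norm_seqComp_succ L (hinv (n + 1) (by omega))
    have hun : 0 ≤ u n := by positivity
    have hΦ : ‖seqComp Φ 0 n‖ ≤ c₁ * ‖seqComp A 0 (n + 1)‖ * (1 + u n) := by
      calc ‖seqComp Φ 0 n‖ ≤ ‖seqComp A 0 n‖ + ‖seqComp A 0 n - seqComp Φ 0 n‖ :=
            norm_le_norm_add_norm_sub _ _
        _ = ‖seqComp A 0 n‖ * (1 + u n) := by
            have := (hpos n).ne'
            simp only [hu_def]
            field_simp
        _ ≤ _ := by gcongr
    calc _ ≤ ‖seqComp A (n + 1) M‖ * (‖A (n + 1) - Φ (n + 1)‖ * ‖seqComp Φ 0 n‖) :=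
          (ContinuousLinearMap.opNorm_comp_le _ _).trans
            (mul_le_mul_of_nonneg_left (ContinuousLinearMap.opNorm_comp_le _ _) (norm_nonneg _))
      _ ≤ ‖seqComp A (n + 1) M‖ * (c₃ * (h ^ (p + 1) * ht (n + 1) ^ (p + 1)) *
            (c₁ * ‖seqComp A 0 (n + 1)‖ * (1 + u n))) := by gcongr
      _ = ‖seqComp A (n + 1) M‖ * ‖seqComp A 0 (n + 1)‖ *
            (c₁ * (c₃ * (h ^ (p + 1) * ht (n + 1) ^ (p + 1))) * (1 + u n)) := by ring
      _ ≤ c₂ * ‖seqComp A 0 M‖ *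
            (c₁ * (c₃ * (h ^ (p + 1) * ht (n + 1) ^ (p + 1))) * (1 + u n)) :=
          mul_le_mul_of_nonneg_right (hfi (n + 1) M (mem_range.mp hn)) (by positivity)
      _ = β n * (1 + u n) * ‖seqComp A 0 M‖ := by
          simp only [hβ_def]
          ring
  have hsumβ : ∑ n ∈ range N, β n ≤ c₁ * c₂ * c₃ * h ^ (p + 1) * S := by
    rw [hβ_def, ← mul_sum]
    exact mul_le_mul_of_nonneg_left (hsum.sum_le_tsum _ fun n _ => hpow n) (by positivity)
  rw [← div_le_iff₀ (hpos N)]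
  calc u N ≤ Real.exp (c₁ * c₂ * c₃ * h ^ (p + 1) * S) - 1 := by
        linarith [one_add_le_exp_sum_of_le_sum hβ hu N, Real.exp_le_exp.mpr hsumβ]
    _ ≤ c₁ * c₂ * c₃ * h ^ (p + 1) * S * Real.exp (c₁ * c₂ * c₃ * h ^ (p + 1) * S) :=
        exp_sub_one_le_mul_exp _
    _ ≤ c₁ * c₂ * c₃ * h ^ (p + 1) * S * Real.exp (c₁ * c₂ * c₃ * 1 * S) := by gcongr
    _ = _ := by
        rw [mul_one]
        ring
end

section
/- Let λ₁ > λ₂ be reals, α₁, α₂ ∈ ℝ with α₁ ≠ 0, and let h > 0 satisfy 0 < 1 + hλ₂ < 1 + hλ₁. With constant stepsizes h_n = h, define μ₁(N) := (1/(2hN)) · log( α₁² (1+hλ₁)^{2N} + α₂² (1+hλ₂)^{2N} ). Then lim_{N→∞} μ₁(N) = log(1 + hλ₁)/h. In particular, Benettin's algorithm with the Euler method and constant stepsize h converges to log(1+hλ₁)/h rather than to the Lyapunov exponent λ₁. -/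
open Filter

/-- The exponential growth rate of a sum of two geometric sequences is that of the larger one. -/
theorem tendsto_log_add_geometric_div {a b c d : ℝ} (hb : 0 < b) (hba : b < a) (hc : 0 < c)
    (hd : 0 ≤ d) :
    Tendsto (fun n : ℕ => Real.log (c * a ^ n + d * b ^ n) / n) atTop (nhds (Real.log a)) := by
  have ha : 0 < a := hb.trans hba
  have hratio : Tendsto (fun n : ℕ => (b / a) ^ n) atTop (nhds 0) :=
    tendsto_pow_atTop_nhds_zero_of_lt_one (by positivity) ((div_lt_one ha).2 hba)
  have hsum : Tendsto (fun n : ℕ => c + d * (b / a) ^ n) atTop (nhds c) := by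
    simpa using (hratio.const_mul d).const_add c
  have herr : Tendsto (fun n : ℕ => Real.log (c + d * (b / a) ^ n) / n) atTop (nhds 0) :=
    (hsum.log hc.ne').div_atTop tendsto_natCast_atTop_atTop
  have hlim := herr.const_add (Real.log a)
  rw [add_zero] at hlim
  refine hlim.congr' ?_
  filter_upwards [eventually_ne_atTop 0] with n hn
  have hfactor : c * a ^ n + d * b ^ n = a ^ n * (c + d * (b / a) ^ n) := by
    rw [div_pow]
    field_simp
  have hn' : (n : ℝ) ≠ 0 := Nat.cast_ne_zero.2 hn
  rw [hfactor, Real.log_mul (by positivity) (by positivity), Real.log_pow]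
  field_simp

/-- **Persistent error of Benettin's algorithm with constant stepsizes.**
Let `λ₁ > λ₂`, `α₁ ≠ 0`, and `h > 0` with `0 < 1 + hλ₂ < 1 + hλ₁`. With constant stepsizes
`h_n = h`, the output `μ₁(N) = (1/(2hN)) log (α₁² (1+hλ₁)^{2N} + α₂² (1+hλ₂)^{2N})` of
Benettin's algorithm with the Euler method converges, as `N → ∞`, to `log (1 + hλ₁) / h`
(rather than to the Lyapunov exponent `λ₁`). -/
theorem benettin_euler_constant_stepsize_limit
    (lam₁ lam₂ : ℝ) (hlam : lam₂ < lam₁)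
    (α₁ α₂ : ℝ) (hα₁ : α₁ ≠ 0)
    (h : ℝ) (hh : 0 < h)
    (hpos : 0 < 1 + h * lam₂) (hlt : 1 + h * lam₂ < 1 + h * lam₁) :
    Tendsto (fun N : ℕ =>
        (1 / (2 * h * (N : ℝ))) *
          Real.log (α₁ ^ 2 * (1 + h * lam₁) ^ (2 * N) + α₂ ^ 2 * (1 + h * lam₂) ^ (2 * N)))
      atTop (nhds (Real.log (1 + h * lam₁) / h)) := by
  have hlim := (tendsto_log_add_geometric_div (pow_pos hpos 2)
    (pow_lt_pow_left₀ hlt hpos.le two_ne_zero) (sq_pos_of_ne_zero hα₁) (sq_nonneg α₂)).const_mul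
    (1 / (2 * h))
  convert hlim using 2
  · simp only [pow_mul]
    ring
  · rw [Real.log_pow]
    push_cast
    field_simp
end

section
/- Let E be a finite-dimensional real inner product space, u₁ ∈ E a unit vector, and V₂ := (span{u₁})^⊥ its orthogonal complement. Let v₁ute = α u₁ + v₂ with α ≠ 0 and v₂ ∈ V₂ be the decomposition of a vector v₁ ∈ E ∖ V₂. Let (h₀^N)_{N≥1} be positive reals with h₀^N → ∞, let λ₁ ∈ ℝ, and let (A_N)_{N≥1} and (Ψ_N)_{N≥1} be sequences of continuous linear maps on E with A_N ≠ 0 satisfying: (a) (1/h₀^N) log‖A_N‖ → λ₁ as N → ∞; (b) there exist c₁, γ₁ > 0 with ‖A_N u₁‖ ≥ (1 − c₁ e^{−γ₁ h₀^N}) ‖A_N‖ for all N; (c) there exist c₂, γ₂ > 0 with ‖A_N v‖ ≤ c₂ e^{−γ₂ h₀^N} ‖A_N‖ ‖v‖ for all v ∈ V₂ and all N; (d) there exists ε ≥ 0 with ε ‖v₁‖ < |α| and ‖Ψ_N − A_N‖ ≤ ε ‖A_N‖ for all N. Then lim_{N→∞} (1/h₀^N) log‖Ψ_N v₁‖ =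 λ₁. -/
open Filter

/-- Logarithmic growth rates are unchanged under two-sided comparison up to constants. -/
theorem tendsto_one_div_mul_log_of_le_of_le {ι : Type*} {l : Filter ι} {h f g : ι → ℝ}
    {a κ K : ℝ} (hh : Tendsto h l atTop) (hκ : 0 < κ) (hK : 0 < K)
    (hg : ∀ᶠ i in l, 0 < g i) (hlo : ∀ᶠ i in l, κ * g i ≤ f i) (hup : ∀ᶠ i in l, f i ≤ K * g i)
    (hlim : Tendsto (fun i => (1 / h i) * Real.log (g i)) l (nhds a)) :
    Tendsto (fun i => (1 / h i) * Real.log (f i)) l (nhds a) := by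
  have key : ∀ C : ℝ, Tendsto (fun i => (1 / h i) * C + (1 / h i) * Real.log (g i)) l (nhds a) := by
    intro C
    have h1 : Tendsto (fun i => 1 / h i) l (nhds 0) := hh.const_div_atTop 1
    simpa using (h1.mul_const C).add hlim
  refine tendsto_of_tendsto_of_tendsto_of_le_of_le' (key (Real.log κ)) (key (Real.log K)) ?_ ?_
  · filter_upwards [hg, hlo, hh.eventually_gt_atTop 0] with i hgi hloi hhi
    rw [← mul_add, ← Real.log_mul hκ.ne' hgi.ne']
    gcongr
  · filter_upwards [hg, hlo, hup, hh.eventually_gt_atTop 0] with i hgi hloi hupi hhi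
    have hf : 0 < f i := (mul_pos hκ hgi).trans_le hloi
    rw [← mul_add, ← Real.log_mul hK.ne' hgi.ne']
    gcongr

/-- `c e^{-γ h} → 0` when `h → ∞` and `γ > 0`. -/
theorem tendsto_const_mul_exp_neg_mul {ι : Type*} {l : Filter ι} {h : ι → ℝ}
    (hh : Tendsto h l atTop) (c : ℝ) {γ : ℝ} (hγ : 0 < γ) :
    Tendsto (fun i => c * Real.exp (-γ * h i)) l (nhds 0) := by
  have h1 : Tendsto (fun i => Real.exp (-γ * h i)) l (nhds 0) :=
    Real.tendsto_exp_atBot.comp (hh.const_mul_atTop_of_neg (neg_lt_zero.mpr hγ))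
  simpa using h1.const_mul c

/-- **Deterministic core of the convergence of Benettin's algorithm for the largest
Lyapunov exponent.**
Let `E` be a finite-dimensional real inner product space, `u₁` a unit vector,
`V₂ = (span {u₁})ᗮ`, and `v₁ = α • u₁ + v₂` with `α ≠ 0`, `v₂ ∈ V₂`. Let `(h₀^N)_{N≥1}` be
positive reals tending to `∞`, `λ₁ ∈ ℝ`, and `(A N)`, `(Ψ N)` continuous linear maps on `E`
with `A N ≠ 0`, such that:
(a) `(1/h₀^N) log ‖A N‖ → λ₁`;
(b) there are `c₁, γ₁ > 0` with `‖A N u₁‖ ≥ (1 - c₁ e^{-γ₁ h₀^N}) ‖A N‖` for all `N ≥ 1`;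
(c) there are `c₂, γ₂ > 0` with `‖A N v‖ ≤ c₂ e^{-γ₂ h₀^N} ‖A N‖ ‖v‖` for all `v ∈ V₂`, `N ≥ 1`;
(d) there is `ε ≥ 0` with `ε ‖v₁‖ < |α|` and `‖Ψ N - A N‖ ≤ ε ‖A N‖` for all `N ≥ 1`.
Then `(1/h₀^N) log ‖Ψ N v₁‖ → λ₁` as `N → ∞`. -/
theorem benettin_deterministic_core
    {E : Type*} [NormedAddCommGroup E] [InnerProductSpace ℝ E] [FiniteDimensional ℝ E]
    (u₁ : E) (hu₁ : ‖u₁‖ = 1)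
    (α : ℝ) (hα : α ≠ 0) (v₂ : E) (hv₂ : v₂ ∈ (ℝ ∙ u₁)ᗮ)
    (h₀ : ℕ → ℝ) (hh₀pos : ∀ N, 1 ≤ N → 0 < h₀ N)
    (hh₀top : Tendsto h₀ atTop atTop)
    (lam₁ : ℝ) (A Ψ : ℕ → E →L[ℝ] E) (hA : ∀ N, 1 ≤ N → A N ≠ 0)
    (ha : Tendsto (fun N => (1 / h₀ N) * Real.log ‖A N‖) atTop (nhds lam₁))
    (hb : ∃ c₁ > (0 : ℝ), ∃ γ₁ > (0 : ℝ), ∀ N, 1 ≤ N →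
      (1 - c₁ * Real.exp (-γ₁ * h₀ N)) * ‖A N‖ ≤ ‖A N u₁‖)
    (hc : ∃ c₂ > (0 : ℝ), ∃ γ₂ > (0 : ℝ), ∀ N, 1 ≤ N → ∀ v ∈ (ℝ ∙ u₁)ᗮ,
      ‖A N v‖ ≤ c₂ * Real.exp (-γ₂ * h₀ N) * ‖A N‖ * ‖v‖)
    (hd : ∃ ε ≥ (0 : ℝ), ε * ‖α • u₁ + v₂‖ < |α| ∧ ∀ N, 1 ≤ N → ‖Ψ N - A N‖ ≤ ε * ‖A N‖) :
    Tendsto (fun N => (1 / h₀ N) * Real.log ‖Ψ N (α • u₁ + v₂)‖) atTop (nhds lam₁) := by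
  obtain ⟨c₁, -, γ₁, hγ₁, hb⟩ := hb
  obtain ⟨c₂, -, γ₂, hγ₂, hc⟩ := hc
  obtain ⟨ε, hε, hεα, hd⟩ := hd
  set v₁ := α • u₁ + v₂ with hv₁
  have hloss : Tendsto (fun N => |α| * (c₁ * Real.exp (-γ₁ * h₀ N))
      + (c₂ * Real.exp (-γ₂ * h₀ N)) * ‖v₂‖) atTop (nhds 0) := by
    simpa using ((tendsto_const_mul_exp_neg_mul hh₀top c₁ hγ₁).const_mul |α|).add
      ((tendsto_const_mul_exp_neg_mul hh₀top c₂ hγ₂).mul_const ‖v₂‖)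
  have hκ : 0 < (|α| - ε * ‖v₁‖) / 2 := by linarith
  have hK : 0 < (1 + ε) * ‖v₁‖ + 1 := by positivity
  have herr : ∀ N, 1 ≤ N → ‖Ψ N v₁ - A N v₁‖ ≤ ε * ‖A N‖ * ‖v₁‖ := fun N hN =>
    ((Ψ N - A N).le_opNorm v₁).trans (by gcongr; exact hd N hN)
  refine tendsto_one_div_mul_log_of_le_of_le hh₀top hκ hK ?_ ?_ ?_ ha
  · filter_upwards [eventually_ge_atTop 1] with N hN
    exact norm_pos_iff.mpr (hA N hN)
  · filter_upwards [eventually_ge_atTop 1, hloss.eventually_lt_const hκ] with N hN hsmall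
    have hAv : |α| * ‖A N u₁‖ - ‖A N v₂‖ ≤ ‖A N v₁‖ := by
      have h := norm_sub_le (A N v₁) (A N v₂)
      rw [← map_sub, hv₁, add_sub_cancel_right, map_smul, norm_smul, Real.norm_eq_abs] at h
      linarith
    have hΨ : ‖A N v₁‖ - ‖Ψ N v₁‖ ≤ ‖Ψ N v₁ - A N v₁‖ := by
      rw [norm_sub_rev]
      exact norm_sub_norm_le _ _
    have hu := mul_le_mul_of_nonneg_left (hb N hN) (abs_nonneg α)
    have hs := mul_le_mul_of_nonneg_right hsmall.le (norm_nonneg (A N))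
    linarith [hc N hN v₂ hv₂, herr N hN]
  · filter_upwards [eventually_ge_atTop 1] with N hN
    have hΨ : ‖Ψ N v₁‖ - ‖A N v₁‖ ≤ ‖Ψ N v₁ - A N v₁‖ := norm_sub_norm_le _ _
    linarith [(A N).le_opNorm v₁, herr N hN, norm_nonneg (A N)]
end
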